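/- There exists a constant C > 0 such that for every integer n ≥ 2, every integer k with 2 ≤ k ≤ n, and every δ ∈ (0,1), there is a non-adaptive randomized algorithm making at most C · n · log log(n/δ) · k · log(k/δ) subset queries (log denoting the base-2 logarithm) which, for every partition of an n-point set U into at most k clusters, outputs exactly that partition with probability at least 1 − δ. -/

import Mathlib

open scoped ENNReal

/-- `count(S)`: the number of clusters (under the cluster labeling `c`) intersecting
the query set `S`. -/
def clusterCount {U K : Type*} [DecidableEq K] (c : U → K) (S : Finset U) : ℕ :=
  (S.image c).card

open Finset

section Freq

open scoped Classical in
/-- The proportion of elements of a finite type satisfying a predicate. -/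
noncomputable def freq {Ω : Type*} [Fintype Ω] (P : Ω → Prop) : ℝ :=
  (#{ω | P ω} : ℝ) / Fintype.card Ω

variable {Ω Ω' : Type*} [Fintype Ω] [Fintype Ω']

theorem freq_mono {P Q : Ω → Prop} (h : ∀ ω, P ω → Q ω) : freq P ≤ freq Q := by
  unfold freq
  gcongr with ω
  exact h ω

theorem freq_nonneg (P : Ω → Prop) : 0 ≤ freq P := by
  unfold freq; positivity

theorem freq_or_le (P Q : Ω → Prop) : freq (fun ω => P ω ∨ Q ω) ≤ freq P + freq Q := by
  classical
  unfold freq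
  rw [← add_div]
  gcongr
  have h := card_union_le ({ω | P ω} : Finset Ω) {ω | Q ω}
  rw [← filter_or] at h
  norm_cast
  convert h

theorem freq_exists_le {ι : Type*} [Fintype ι] {P : ι → Ω → Prop} {ε : ℝ}
    (h : ∀ i, freq (P i) ≤ ε) : freq (fun ω => ∃ i, P i ω) ≤ Fintype.card ι * ε := by
  classical
  calc freq (fun ω => ∃ i, P i ω) ≤ ∑ i, freq (P i) := by
        unfold freq
        rw [← sum_div]
        gcongr
        have : ({ω | ∃ i, P i ω} : Finset Ω) ⊆ univ.biUnion fun i => {ω | P i ω} := by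
          intro ω; simp
        have h' := (card_le_card this).trans card_biUnion_le
        refine le_trans (le_of_eq ?_) (Nat.cast_le.2 h') |>.trans_eq (Nat.cast_sum _ _)
        congr!
    _ ≤ ∑ _i : ι, ε := sum_le_sum fun i _ => h i
    _ = _ := by simp

theorem freq_not [Nonempty Ω] (P : Ω → Prop) : freq (fun ω => ¬ P ω) = 1 - freq P := by
  classical
  unfold freq
  have h := card_filter_add_card_filter_not (s := (univ : Finset Ω)) P
  have h0 : (0 : ℝ) < Fintype.card Ω := by exact_mod_cast Fintype.card_pos
  rw [card_univ] at h
  field_simp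
  rw [← h]
  push_cast
  ring

theorem freq_equiv (e : Ω ≃ Ω') (P : Ω' → Prop) : freq (fun ω => P (e ω)) = freq P := by
  classical
  unfold freq
  rw [Fintype.card_congr e]
  congr 2
  exact card_equiv e (by simp)

theorem freq_prod_le [Nonempty Ω] {P : Ω × Ω' → Prop} {ε : ℝ}
    (h : ∀ ω, freq (fun ω' => P (ω, ω')) ≤ ε) : freq P ≤ ε := by
  classical
  have h0 : (0 : ℝ) < Fintype.card Ω := by exact_mod_cast Fintype.card_pos
  have key : freq P = (∑ ω, freq fun ω' => P (ω, ω')) / Fintype.card Ω := by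
    unfold freq
    rw [← sum_div, div_div, Fintype.card_prod, Nat.cast_mul, mul_comm (Fintype.card Ω' : ℝ)]
    congr 1
    simp only [card_filter]
    push_cast
    exact Fintype.sum_prod_type _
  rw [key, div_le_iff₀ h0]
  calc _ ≤ ∑ _ω : Ω, ε := sum_le_sum fun ω _ => h ω
    _ = _ := by simp [mul_comm]

theorem freq_fst [Nonempty Ω'] (P : Ω → Prop) :
    freq (fun ω : Ω × Ω' => P ω.1) = freq P := by
  classical
  have h0 : (0 : ℝ) < Fintype.card Ω' := by exact_mod_cast Fintype.card_pos
  unfold freq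
  have : ({ω | P ω.1} : Finset (Ω × Ω')) = ({ω | P ω} : Finset Ω) ×ˢ univ := by
    ext; simp
  rw [this, card_product, Fintype.card_prod, card_univ]
  push_cast
  field_simp

theorem freq_eval {ι : Type*} [Fintype ι] [DecidableEq ι] {α : ι → Type*} [∀ i, Fintype (α i)]
    [∀ i, Nonempty (α i)] (i : ι) (P : α i → Prop) :
    freq (fun f : ∀ i, α i => P (f i)) = freq P := by
  classical
  rw [← freq_fst (Ω' := ∀ j : {j // j ≠ i}, α j) P, ← freq_equiv (Equiv.piSplitAt i α)]
  rfl

theorem freq_forall {ι α : Type*} [Fintype ι] [DecidableEq ι] [Fintype α] (P : ι → α → Prop) :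
    freq (fun f : ι → α => ∀ i, P i (f i)) = ∏ i, freq (P i) := by
  classical
  unfold freq
  have h : ({f | ∀ i, P i (f i)} : Finset (ι → α)) = Fintype.piFinset fun i => {a | P i a} := by
    ext; simp
  have h' := congrArg card h
  rw [Fintype.card_piFinset] at h'
  rw [prod_div_distrib, ← Nat.cast_prod, ← h']
  simp

/-- Markov's inequality for the uniform distribution. -/
theorem freq_lt_le [Nonempty Ω] (f : Ω → ℝ) (hf : ∀ ω, 0 ≤ f ω) {a : ℝ} (ha : 0 < a) :
    freq (fun ω => a < f ω) ≤ (∑ ω, f ω) / Fintype.card Ω / a := by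
  classical
  unfold freq
  rw [div_right_comm]
  gcongr
  rw [le_div_iff₀ ha, ← nsmul_eq_mul]
  calc _ ≤ ∑ ω with a < f ω, f ω := card_nsmul_le_sum _ _ _ fun ω h => by
        simpa using (mem_filter.1 h).2.le
    _ ≤ _ := sum_le_sum_of_subset_of_nonneg (subset_univ _) fun ω _ _ => hf ω

end Freq

section Decoding

variable {U K ι : Type*} [DecidableEq U] [DecidableEq K]

/-- The points whose cluster is disjoint from `R`. -/
def missed [Fintype U] (c : U → K) (R : Finset U) : Finset U := {z | c z ∉ R.image c}

/-- Every point lies in a member of the family `T` containing no other point of `M`. -/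
def Isolates (T : ι → Finset U) (M : Finset U) : Prop :=
  ∀ z, ∃ i, z ∈ T i ∧ ∀ w ∈ T i, w ∈ M → w = z

theorem clusterCount_union_eq_iff [Fintype U] (c : U → K) (R T : Finset U) :
    clusterCount c (R ∪ T) = clusterCount c R ↔ ∀ w ∈ T, w ∉ missed c R := by
  unfold clusterCount missed
  have hsub : R.image c ⊆ (R ∪ T).image c := image_subset_image subset_union_left
  constructor
  · intro h w hw
    have := eq_of_subset_of_card_le hsub h.le
    simp only [mem_filter, mem_univ, true_and, not_not]
    rw [this]
    exact mem_image_of_mem c (mem_union_right R hw)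
  · intro h
    congr 1
    refine subset_antisymm ?_ hsub
    rw [image_union]
    refine union_subset subset_rfl fun a ha => ?_
    obtain ⟨w, hw, rfl⟩ := mem_image.1 ha
    simpa using h w hw

theorem missed_eq_of_clusterCount_eq [Fintype U] {c c' : U → K} {R : Finset U}
    {T : ι → Finset U} (hT : Isolates T (missed c R))
    (hR : clusterCount c' R = clusterCount c R)
    (hRT : ∀ i, clusterCount c' (R ∪ T i) = clusterCount c (R ∪ T i)) :
    missed c' R = missed c R := by
  have key : ∀ i, (∀ w ∈ T i, w ∉ missed c' R) ↔ ∀ w ∈ T i, w ∉ missed c R := fun i => by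
    rw [← clusterCount_union_eq_iff, ← clusterCount_union_eq_iff, hR, hRT]
  have hsub : missed c' R ⊆ missed c R := by
    intro z hz
    by_contra hzc
    obtain ⟨i, hi, h⟩ := hT z
    refine (key i).2 (fun w hw hwM => ?_) z hi hz
    exact hzc (h w hw hwM ▸ hwM)
  refine subset_antisymm hsub fun z hz => ?_
  obtain ⟨i, hi, h⟩ := hT z
  by_contra hzc
  refine (key i).1 (fun w hw hwM => ?_) z hi hz
  exact hzc (h w hw (hsub hwM) ▸ hwM)

/-- The coarsest among the partitions having the given answers. -/
def decode {I : Type*} (K : Type*) [DecidableEq K] (Q : I → Finset U) (v : I → ℕ) : Setoid U :=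
  sSup {s | ∃ c : U → K, (∀ i, clusterCount c (Q i) = v i) ∧ s = Setoid.ker c}

theorem decode_clusterCount [Fintype U] {I : Type*} {Q : I → Finset U} {c : U → K}
    (h : ∀ x y, c x ≠ c y → ∃ R, (∃ i, Q i = R) ∧ (x ∈ missed c R ↔ y ∉ missed c R) ∧
      ∃ (N : ℕ) (T : Fin N → Finset U), (∀ l, ∃ i, Q i = R ∪ T l) ∧ Isolates T (missed c R)) :
    decode K Q (fun i => clusterCount c (Q i)) = Setoid.ker c := by
  refine le_antisymm (sSup_le ?_) (le_sSup ⟨c, fun _ => rfl, rfl⟩)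
  rintro _ ⟨c', hc', rfl⟩ x y hxy
  by_contra hne
  obtain ⟨R, ⟨i, rfl⟩, hsep, N, T, hT, hiso⟩ := h x y hne
  have hM : missed c' (Q i) = missed c (Q i) := by
    refine missed_eq_of_clusterCount_eq hiso (hc' i) fun l => ?_
    obtain ⟨i', hi'⟩ := hT l
    rw [← hi', hc' i']
  rw [← hM] at hsep
  have hxy' : c' x = c' y := hxy
  simp only [missed, mem_filter, mem_univ, true_and, hxy'] at hsep
  tauto

end Decoding

section Tests

universe u

variable {U : Type u} [Fintype U] [DecidableEq U]

theorem freq_collision_le {D : ℕ} (M : Finset U) (hM : 2 * #M < D) (z : U) :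
    freq (fun h : U → Fin D => ∃ w ∈ M, w ≠ z ∧ h w = h z) ≤ 1 / 2 := by
  classical
  have : NeZero D := ⟨by omega⟩
  let e : (U → Fin D) ≃ ({w : U // w ≠ z} → Fin D) × Fin D :=
    (Equiv.funSplitAt z (Fin D)).trans (Equiv.prodComm _ _)
  rw [← freq_equiv e.symm]
  refine freq_prod_le fun h => ?_
  have hD : (0 : ℝ) < D := by exact_mod_cast (by omega : 0 < D)
  unfold freq
  rw [Fintype.card_fin, div_le_iff₀ hD]
  have hsub : ({q | ∃ w ∈ M, w ≠ z ∧ e.symm (h, q) w = e.symm (h, q) z} : Finset (Fin D)) ⊆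
      M.image fun w => if hw : w ≠ z then h ⟨w, hw⟩ else 0 := by
    intro q hq
    obtain ⟨w, hw, hwz, hq⟩ := (mem_filter.1 hq).2
    refine mem_image.2 ⟨w, hw, ?_⟩
    simp [e, Equiv.funSplitAt, Equiv.piSplitAt, hwz] at hq ⊢
    exact hq
  have h1 := (card_le_card hsub).trans card_image_le
  have h2 : (2 : ℝ) * #M ≤ D := by exact_mod_cast hM.le
  refine le_trans (b := (#M : ℝ)) ?_ (by linarith)
  exact_mod_cast h1

theorem freq_not_isolates_le {D : ℕ} (g : ℕ) (M : Finset U) (hM : 2 * #M < D) :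
    freq (fun H : Fin g → U → Fin D =>
        ¬ Isolates (fun p : Fin g × Fin D => ({x | H p.1 x = p.2} : Finset U)) M) ≤
      Fintype.card U * (1 / 2) ^ g := by
  refine le_trans (freq_mono (Q := fun H => ∃ z, ∀ l, ∃ w ∈ M, w ≠ z ∧ H l w = H l z) ?_)
    (freq_exists_le fun z => ?_)
  · intro H hH
    simp only [Isolates, not_forall, not_exists] at hH
    obtain ⟨z, hz⟩ := hH
    refine ⟨z, fun l => ?_⟩
    have := hz (l, H l z)
    simp only [mem_filter, mem_univ, true_and, not_forall] at this
    obtain ⟨w, hw, hwM, hne⟩ := this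
    exact ⟨w, hwM, hne, hw⟩
  · refine (freq_forall fun (_ : Fin g) (h : U → Fin D) => ∃ w ∈ M, w ≠ z ∧ h w = h z).trans_le ?_
    rw [prod_const, card_univ, Fintype.card_fin]
    exact pow_le_pow_left₀ (freq_nonneg _) (freq_collision_le M hM z) g

/-- A random family of at most `min |U| (g * D)` sets which, for each fixed small set `M`,
isolates all points from `M` with high probability. -/
theorem exists_random_isolating (g D : ℕ) (hD : 0 < D) :
    ∃ (N : ℕ) (Ψ : Type u) (_ : Fintype Ψ) (_ : Nonempty Ψ) (T : Ψ → Fin N → Finset U),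
      N ≤ Fintype.card U ∧ N ≤ g * D ∧ ∀ M : Finset U, 2 * #M < D →
        freq (fun ψ => ¬ Isolates (T ψ) M) ≤ Fintype.card U * (1 / 2) ^ g := by
  rcases le_total (Fintype.card U) (g * D) with h | h
  · refine ⟨Fintype.card U, PUnit.{u + 1}, inferInstance, inferInstance,
      fun _ i => {(Fintype.equivFin U).symm i}, le_rfl, h, fun M _ => ?_⟩
    have : Isolates
        (fun i : Fin (Fintype.card U) => ({(Fintype.equivFin U).symm i} : Finset U)) M :=
      fun z => ⟨Fintype.equivFin U z, by simp⟩
    simp only [freq, this, not_true_eq_false, filter_false, card_empty, Nat.cast_zero, zero_div]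
    positivity
  · have : NeZero D := ⟨by omega⟩
    obtain ⟨e⟩ : Nonempty (Fin g × Fin D ≃ Fin (g * D)) := ⟨finProdFinEquiv⟩
    refine ⟨g * D, Fin g → U → Fin D, inferInstance, inferInstance, fun H i =>
      {x | H (e.symm i).1 x = (e.symm i).2}, h, le_rfl, fun M hM => ?_⟩
    have key := freq_not_isolates_le (D := D) g M hM
    refine (freq_mono (fun H hH => ?_)).trans key
    intro hiso
    refine hH fun z => ?_
    obtain ⟨p, hp⟩ := hiso z
    exact ⟨e p, by simpa only [Equiv.symm_apply_apply] using hp⟩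

end Tests

section Sampling

theorem mul_one_sub_pow_le {b : ℝ} (hb : 0 ≤ b) (hb1 : b ≤ 1) {t : ℕ} (ht : 0 < t) :
    b * (1 - b) ^ t ≤ 1 / t := by
  have h1 : (1 - b) ^ t * (1 + b) ^ t ≤ 1 := by
    rw [← mul_pow]
    exact pow_le_one₀ (by nlinarith) (by nlinarith)
  have h2 := one_add_mul_le_pow (by linarith : (-2 : ℝ) ≤ b) t
  have h3 : 0 ≤ (1 - b) ^ t := pow_nonneg (by linarith) t
  have ht' : (0 : ℝ) < t := by exact_mod_cast ht
  rw [le_div_iff₀ ht']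
  nlinarith

theorem le_pow_sub_pow {a b : ℝ} (ha : 0 ≤ a) (hab : a ≤ b) (hs : a + b ≤ 1) {t : ℕ}
    (ht : 0 < t) (hlow : 1 ≤ 8 * t * b) (hup : t = 1 ∨ 4 * t * b ≤ 1) :
    1 / 16 ≤ (1 - a) ^ t - (1 - a - b) ^ t := by
  rcases hup with rfl | hup
  · norm_num at hlow ⊢
    linarith
  · have hb : 0 ≤ b := ha.trans hab
    have ht1 : (1 : ℝ) ≤ t := by exact_mod_cast ht
    have hb4 : b ≤ 1 / 4 := by nlinarith
    have hY : 0 < 1 - a - b := by linarith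
    have h1 := one_add_mul_le_pow (a := -(a + b)) (by linarith) t
    rw [show (1 : ℝ) + -(a + b) = 1 - a - b by ring] at h1
    have h2 := one_add_mul_le_pow (a := b / (1 - a - b)) (by
      have : 0 ≤ b / (1 - a - b) := by positivity
      linarith) t
    have h3 : (1 - a) ^ t = (1 - a - b) ^ t * (1 + b / (1 - a - b)) ^ t := by
      rw [← mul_pow]
      congr 1
      field_simp
      ring
    have h4 : b ≤ b / (1 - a - b) := by
      rw [le_div_iff₀ hY]; nlinarith
    have h5 : (1 : ℝ) / 2 ≤ (1 - a - b) ^ t := by nlinarith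
    have h6 : (1 : ℝ) / 8 ≤ t * (b / (1 - a - b)) := by nlinarith
    rw [h3]
    nlinarith

variable {U K : Type*} [Fintype U]

theorem freq_notMem [Nonempty U] (A : Finset U) :
    freq (fun x : U => x ∉ A) = 1 - #A / Fintype.card U := by
  rw [freq_not]
  simp [freq]

theorem freq_forall_notMem [Nonempty U] (A : Finset U) (t : ℕ) :
    freq (fun u : Fin t → U => ∀ i, u i ∉ A) = (1 - #A / Fintype.card U : ℝ) ^ t := by
  rw [freq_forall fun (_ : Fin t) x => x ∉ A, freq_notMem]
  simp

variable [DecidableEq U] [DecidableEq K]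

theorem mem_missed_image_iff (c : U → K) {t : ℕ} (u : Fin t → U) (z : U) :
    z ∈ missed c (univ.image u) ↔ ∀ i, u i ∉ ({x | c x = c z} : Finset U) := by
  simp [missed]

theorem sum_card_missed_le [Nonempty U] [Fintype K] (c : U → K) {t : ℕ} (ht : 0 < t) :
    (∑ u : Fin t → U, (#(missed c (univ.image u)) : ℝ)) / Fintype.card (Fin t → U) ≤
      Fintype.card K * Fintype.card U / t := by
  classical
  have hN : (0 : ℝ) < Fintype.card U := by exact_mod_cast Fintype.card_pos
  set p : K → ℝ := fun a => #{x | c x = a} / Fintype.card U with hp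
  have h1 : (∑ u : Fin t → U, (#(missed c (univ.image u)) : ℝ)) / Fintype.card (Fin t → U) =
      ∑ z : U, (1 - p (c z)) ^ t := by
    simp only [hp, ← freq_forall_notMem, ← mem_missed_image_iff]
    unfold freq
    rw [← sum_div]
    congr 1
    have := sum_card_bipartiteAbove_eq_sum_card_bipartiteBelow
      (s := (univ : Finset (Fin t → U))) (t := (univ : Finset U))
      fun u z => z ∈ missed c (univ.image u)
    simp only [bipartiteAbove, bipartiteBelow, filter_univ_mem] at this
    rw [← Nat.cast_sum, this, Nat.cast_sum]
    congr!
  rw [h1, ← sum_fiberwise univ c]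
  calc ∑ a, ∑ z with c z = a, (1 - p (c z)) ^ t
      = ∑ a, Fintype.card U * (p a * (1 - p a) ^ t) := by
        refine sum_congr rfl fun a _ => ?_
        rw [sum_congr rfl (g := fun _ => (1 - p a) ^ t) fun z hz => by rw [(mem_filter.1 hz).2],
          sum_const, nsmul_eq_mul, ← mul_assoc, mul_div_cancel₀ _ hN.ne']
    _ ≤ ∑ _a : K, (Fintype.card U : ℝ) * (1 / t) := by
        refine sum_le_sum fun a _ => ?_
        gcongr
        refine mul_one_sub_pow_le (by positivity) ?_ ht
        rw [div_le_one hN]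
        exact_mod_cast card_le_univ _
    _ = _ := by
        rw [sum_const, card_univ, nsmul_eq_mul]; ring

/-- A sample of suitable size hits a given cluster `b`, misses a given cluster `a` that is not
larger, and misses few points overall, with probability bounded below. -/
theorem le_freq_separates [Nonempty U] [Fintype K] (c : U → K) {a b : K} (hne : a ≠ b)
    (hab : #{x | c x = a} ≤ #{x | c x = b}) {t : ℕ} (ht : 0 < t)
    (hlow : Fintype.card U ≤ 8 * t * #{x | c x = b})
    (hup : t = 1 ∨ 4 * t * #{x | c x = b} ≤ Fintype.card U) :
    1 / 32 ≤ freq fun u : Fin t → U => (∀ i, c (u i) ≠ a) ∧ (∃ i, c (u i) = b) ∧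
      t * #(missed c (univ.image u)) ≤ 32 * Fintype.card K * Fintype.card U := by
  have hN : (0 : ℝ) < Fintype.card U := by exact_mod_cast Fintype.card_pos
  have ht' : (0 : ℝ) < t := by exact_mod_cast ht
  have hK : (0 : ℝ) < Fintype.card K := by exact_mod_cast Fintype.card_pos_iff.2 ⟨a⟩
  set A : Finset U := {x | c x = a} with hA
  set B : Finset U := {x | c x = b} with hB
  have hdisj : Disjoint A B := by
    rw [disjoint_left]
    simp only [hA, hB, mem_filter, mem_univ, true_and]
    exact fun x h h' => hne (h.symm.trans h')
  have hsum : #(A ∪ B) = #A + #B := card_union_of_disjoint hdisj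
  have hsum' : #A + #B ≤ Fintype.card U := hsum ▸ card_le_univ _
  have h1 := le_pow_sub_pow (a := #A / Fintype.card U) (b := #B / Fintype.card U) (t := t)
    (by positivity) (by gcongr) (by rw [← add_div, div_le_one hN]; exact_mod_cast hsum') ht
    (by rw [← mul_div_assoc, one_le_div hN]; exact_mod_cast hlow)
    (hup.imp_right fun h => by rw [← mul_div_assoc, div_le_one hN]; exact_mod_cast h)
  have h2 := freq_forall_notMem A t
  have h3 := freq_forall_notMem (A ∪ B) t
  rw [hsum, Nat.cast_add, add_div, ← sub_sub] at h3
  have h4 := (freq_lt_le (fun u : Fin t → U => (#(missed c (univ.image u)) : ℝ))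
    (fun _ => by positivity) (a := 32 * Fintype.card K * Fintype.card U / t)
    (by positivity)).trans (div_le_div_of_nonneg_right (sum_card_missed_le c ht) (by positivity))
  have h5 : (Fintype.card K * Fintype.card U / t : ℝ) / (32 * Fintype.card K * Fintype.card U / t)
      = 1 / 32 := by
    field_simp
  rw [h5] at h4
  rw [← h2, ← h3] at h1
  have h6 : freq (fun u : Fin t → U => ∀ i, u i ∉ A) ≤ _ :=
    le_trans (freq_mono (Q := fun u : Fin t → U => ((∀ i, c (u i) ≠ a) ∧ (∃ i, c (u i) = b) ∧
      t * #(missed c (univ.image u)) ≤ 32 * Fintype.card K * Fintype.card U) ∨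
      ((∀ i, u i ∉ A ∪ B) ∨
      32 * Fintype.card K * Fintype.card U / t < (#(missed c (univ.image u)) : ℝ)))
      fun u hu => by
        by_cases hb : ∃ i, c (u i) = b
        · by_cases hm : t * #(missed c (univ.image u)) ≤ 32 * Fintype.card K * Fintype.card U
          · exact Or.inl ⟨fun i => by simpa [hA] using hu i, hb, hm⟩
          · refine Or.inr (Or.inr ?_)
            rw [div_lt_iff₀ ht', mul_comm _ (t : ℝ)]
            exact_mod_cast not_le.1 hm
        · refine Or.inr (Or.inl fun i => ?_)
          rw [mem_union, not_or]
          exact ⟨hu i, by simpa [hB] using fun h => hb ⟨i, h⟩⟩)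
      ((freq_or_le _ _).trans (add_le_add le_rfl (freq_or_le _ _)))
  linarith

theorem exists_scale {n β : ℕ} (hβ : 0 < β) :
    ∃ j < Nat.log 2 n + 1, n ≤ 8 * 2 ^ j * β ∧ (2 ^ j = 1 ∨ 4 * 2 ^ j * β ≤ n) := by
  rcases lt_or_ge n (4 * β) with h | h
  · exact ⟨0, by omega, by omega, Or.inl rfl⟩
  · have h4 : n / (4 * β) ≠ 0 := (Nat.div_pos h (by omega)).ne'
    refine ⟨Nat.log 2 (n / (4 * β)), Nat.lt_succ_of_le
      (Nat.log_mono_right (Nat.div_le_self _ _)), ?_, Or.inr ?_⟩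
    · have := Nat.lt_pow_succ_log_self one_lt_two (n / (4 * β))
      rw [Nat.div_lt_iff_lt_mul (by omega), pow_succ] at this
      nlinarith
    · have := Nat.pow_log_le_self 2 h4
      rw [Nat.le_div_iff_mul_le (by omega)] at this
      linarith

end Sampling

section Scheme

theorem exists_random_queries (n k r g : ℕ) (hn : 0 < n) :
    ∃ (m : ℕ) (Ω : Type) (_ : Fintype Ω) (_ : Nonempty Ω) (Q : Ω → Fin m → Finset (Fin n)),
      m ≤ r * ∑ j ∈ range (Nat.log 2 n + 1), (1 + min n (g * (64 * k * n / 2 ^ j + 1))) ∧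
      ∀ c : Fin n → Fin k,
        freq (fun ω => decode (Fin k) (Q ω) (fun i => clusterCount c (Q ω i)) ≠ Setoid.ker c) ≤
          k ^ 2 * ((31 / 32) ^ r + n * (1 / 2) ^ g) := by
  classical
  have : NeZero n := ⟨hn.ne'⟩
  set s := Nat.log 2 n + 1
  choose N Ψ hΨ hΨ' T hNn hNg hT using fun j : Fin s =>
    exists_random_isolating (U := Fin n) g (64 * k * n / 2 ^ (j : ℕ) + 1) (Nat.succ_pos _)
  let I := Fin r × (Σ j : Fin s, Option (Fin (N j)))
  let Ω := (∀ j : Fin s, Fin r → Fin (2 ^ (j : ℕ)) → Fin n) × ∀ j, Ψ j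
  let R : Ω → Fin r → Fin s → Finset (Fin n) := fun ω i j => univ.image (ω.1 j i)
  let Q : Ω → I → Finset (Fin n) := fun ω p =>
    R ω p.1 p.2.1 ∪ p.2.2.elim ∅ (T p.2.1 (ω.2 p.2.1))
  let e : Fin (Fintype.card I) ≃ I := (Fintype.equivFin I).symm
  refine ⟨Fintype.card I, Ω, inferInstance, inferInstance, fun ω i => Q ω (e i), ?_, fun c => ?_⟩
  · simp only [I, Fintype.card_prod, Fintype.card_fin, Fintype.card_sigma, Fintype.card_option]
    rw [← Fin.sum_univ_eq_sum_range fun j => 1 + min n (g * (64 * k * n / 2 ^ j + 1))]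
    refine Nat.mul_le_mul_left r (sum_le_sum fun j _ => ?_)
    have h1 := hNn j
    have h2 := hNg j
    rw [Fintype.card_fin] at h1
    rw [add_comm]
    exact Nat.add_le_add_left (le_min h1 h2) 1
  let sep : Fin k → Fin k → (j : Fin s) → (Fin (2 ^ (j : ℕ)) → Fin n) → Prop := fun a b j u =>
    (∀ i, c (u i) ≠ a) ∧ (∃ i, c (u i) = b) ∧
      2 ^ (j : ℕ) * #(missed c (univ.image u)) ≤ 32 * k * n
  let bad : Fin k × Fin k → Ω → Prop := fun p ω =>
    p.1 ≠ p.2 ∧ 0 < #{x | c x = p.2} ∧ #{x | c x = p.1} ≤ #{x | c x = p.2} ∧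
      ∀ j i, sep p.1 p.2 j (ω.1 j i) → ¬ Isolates (T j (ω.2 j)) (missed c (R ω i j))
  refine le_trans (freq_mono (Q := fun ω => ∃ p, bad p ω) fun ω hω => ?_) <|
    (freq_exists_le (ε := (31 / 32) ^ r + n * (1 / 2) ^ g) fun p => ?_).trans_eq ?_
  · by_contra hgood
    simp only [not_exists] at hgood
    have hsep : ∀ x y, c x ≠ c y → #{z | c z = c x} ≤ #{z | c z = c y} →
        ∃ i j, x ∈ missed c (R ω i j) ∧ y ∉ missed c (R ω i j) ∧
          Isolates (T j (ω.2 j)) (missed c (R ω i j)) := by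
      intro x y hne hle
      by_contra! hcon
      refine hgood (c x, c y) ⟨hne, card_pos.2 ⟨y, by simp⟩, hle, fun j i hs => ?_⟩
      refine hcon i j ?_ ?_
      · simpa [missed, R] using hs.1
      · simpa [missed, R] using hs.2.1
    refine hω (decode_clusterCount fun x y hne => ?_)
    have hQ : ∀ i j, (∃ q, Q ω (e q) = R ω i j) ∧
        ∀ l, ∃ q, Q ω (e q) = R ω i j ∪ T j (ω.2 j) l := fun i j =>
      ⟨⟨e.symm (i, ⟨j, none⟩), by simp [Q]⟩, fun l => ⟨e.symm (i, ⟨j, some l⟩), by simp [Q]⟩⟩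
    rcases le_total #{z | c z = c x} #{z | c z = c y} with h | h
    · obtain ⟨i, j, hx, hy, hiso⟩ := hsep x y hne h
      exact ⟨R ω i j, (hQ i j).1, by tauto, N j, T j (ω.2 j), (hQ i j).2, hiso⟩
    · obtain ⟨i, j, hx, hy, hiso⟩ := hsep y x hne.symm h
      exact ⟨R ω i j, (hQ i j).1, by tauto, N j, T j (ω.2 j), (hQ i j).2, hiso⟩
  · obtain ⟨a, b⟩ := p
    have hε : (0 : ℝ) ≤ (31 / 32) ^ r + n * (1 / 2) ^ g := by positivity
    by_cases hp : a ≠ b ∧ 0 < #{x | c x = b} ∧ #{x | c x = a} ≤ #{x | c x = b}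
    swap
    · refine le_trans (le_of_eq ?_) hε
      have : ∀ ω, ¬ bad (a, b) ω := fun ω hω => hp ⟨hω.1, hω.2.1, hω.2.2.1⟩
      simp [freq, this]
    obtain ⟨hne, hpos, hle⟩ := hp
    obtain ⟨j, hj, hlow, hup⟩ := exists_scale (n := n) hpos
    lift j to Fin s using hj
    have hfreq := le_freq_separates c hne hle (t := 2 ^ (j : ℕ)) (by positivity)
      (by simpa using hlow) (by simpa using hup)
    simp only [Fintype.card_fin] at hfreq
    change 1 / 32 ≤ freq (sep a b j) at hfreq
    refine le_trans (freq_mono (Q := fun ω => (∀ i, ¬ sep a b j (ω.1 j i)) ∨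
      ((∃ i, sep a b j (ω.1 j i)) ∧ ∀ i, sep a b j (ω.1 j i) →
        ¬ Isolates (T j (ω.2 j)) (missed c (univ.image (ω.1 j i))))) fun ω hω => ?_)
      ((freq_or_le _ _).trans (add_le_add ?_ ?_))
    · by_cases h : ∃ i, sep a b j (ω.1 j i)
      · exact Or.inr ⟨h, hω.2.2.2 j⟩
      · exact Or.inl (not_exists.1 h)
    · rw [freq_fst fun u : ∀ j : Fin s, Fin r → Fin (2 ^ (j : ℕ)) → Fin n =>
          ∀ i, ¬ sep a b j (u j i),
        freq_eval (α := fun j : Fin s => Fin r → Fin (2 ^ (j : ℕ)) → Fin n) j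
          fun v => ∀ i, ¬ sep a b j (v i),
        freq_forall fun _ v => ¬ sep a b j v, prod_const, card_univ, Fintype.card_fin]
      refine pow_le_pow_left₀ (freq_nonneg _) ?_ r
      rw [freq_not]
      linarith
    · refine freq_prod_le fun u => ?_
      by_cases h : ∃ i, sep a b j (u j i)
      · obtain ⟨i, hi⟩ := h
        refine le_trans (freq_mono (Q := fun ψ : ∀ j, Ψ j =>
          ¬ Isolates (T j (ψ j)) (missed c (univ.image (u j i)))) fun ψ hψ => hψ.2 i hi) ?_
        rw [freq_eval (α := Ψ) j fun ψ => ¬ Isolates (T j ψ) (missed c (univ.image (u j i)))]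
        refine (hT j _ ?_).trans_eq (by rw [Fintype.card_fin])
        rw [Nat.lt_succ_iff, Nat.le_div_iff_mul_le (by positivity)]
        linarith [hi.2.2]
      · refine le_trans (le_of_eq ?_) (by positivity : (0 : ℝ) ≤ n * (1 / 2) ^ g)
        simp [freq, h]
  · simp [sq]

end Scheme

section Bounds

theorem half_pow_ceil_logb_le {x : ℝ} (hx : 0 < x) : (1 / 2 : ℝ) ^ ⌈Real.logb 2 x⌉₊ ≤ 1 / x := by
  rw [div_pow, one_pow]
  gcongr
  rw [← Real.rpow_natCast, ← Real.logb_le_iff_le_rpow one_lt_two hx]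
  exact Nat.le_ceil _

theorem ceil_logb_two_mul_pow_div_le {x δ : ℝ} (hx : 2 ≤ x) (hδ : 0 < δ) (hδ1 : δ < 1) (p : ℕ)
    (hp : 1 ≤ p) : (⌈Real.logb 2 (2 * x ^ p / δ)⌉₊ : ℝ) ≤ (p + 2) * Real.logb 2 (x / δ) := by
  have hxδ : 2 ≤ x / δ := by
    rw [le_div_iff₀ hδ]; nlinarith
  have hL : 1 ≤ Real.logb 2 (x / δ) := by
    rw [Real.le_logb_iff_rpow_le one_lt_two (by linarith)]; simpa using hxδ
  have hle : 2 * x ^ p / δ ≤ 2 * (x / δ) ^ p := by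
    rw [div_pow, ← mul_div_assoc]
    gcongr
    exact pow_le_of_le_one hδ.le hδ1.le (by omega)
  have hlog : Real.logb 2 (2 * x ^ p / δ) ≤ 1 + p * Real.logb 2 (x / δ) := by
    refine (Real.logb_le_logb_of_le one_lt_two (by positivity) hle).trans_eq ?_
    rw [Real.logb_mul two_ne_zero (by positivity), Real.logb_pow, Real.logb_self_eq_one one_lt_two]
  have h0 : 0 ≤ Real.logb 2 (2 * x ^ p / δ) := by
    refine Real.logb_nonneg one_lt_two ?_
    rw [one_le_div hδ]
    have : 1 ≤ x ^ p := one_le_pow₀ (by linarith)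
    linarith
  have := Nat.ceil_lt_add_one h0
  linarith

theorem sum_one_add_min_le {n k g l : ℕ} (hn : 2 ≤ n) (hk : 1 ≤ k) (hg : g ≤ 2 ^ l) :
    ((∑ j ∈ range (Nat.log 2 n + 1), (1 + min n (g * (64 * k * n / 2 ^ j + 1))) : ℕ) : ℝ) ≤
      n + l * n + 130 * k * n := by
  set s := Nat.log 2 n + 1 with hs
  have hsn : s ≤ n := Nat.log_lt_self 2 (by omega)
  let f : ℕ → ℕ := fun j => if j < s then min n (g * (64 * k * n / 2 ^ j + 1)) else 0
  have h1 : ∑ j ∈ range s, (1 + min n (g * (64 * k * n / 2 ^ j + 1))) ≤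
      s + ((∑ j ∈ range l, f j) + ∑ i ∈ range s, f (l + i)) := by
    rw [← sum_range_add, sum_add_distrib, sum_const, card_range, smul_eq_mul, mul_one]
    gcongr
    calc _ = ∑ j ∈ range s, f j := sum_congr rfl fun j hj => (if_pos (mem_range.1 hj)).symm
      _ ≤ _ := sum_le_sum_of_subset (range_subset_range.2 (by omega))
  have h2 : ∑ j ∈ range l, f j ≤ l * n := by
    refine (sum_le_card_nsmul _ _ n fun j _ => ?_).trans_eq (by simp)
    simp only [f]
    split_ifs <;> omega
  have h3 : ∀ i, (f (l + i) : ℝ) ≤ 65 * k * n * (1 / 2) ^ i := by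
    intro i
    simp only [f]
    split_ifs with h
    swap
    · simp only [Nat.cast_zero]; positivity
    have hpow : 2 ^ (l + i) ≤ n :=
      (Nat.pow_le_pow_right (by norm_num) (by omega)).trans (Nat.pow_log_le_self 2 (by omega))
    have hpow' : (2 ^ (l + i) : ℝ) ≤ k * n := by
      exact_mod_cast hpow.trans (Nat.le_mul_of_pos_left n hk)
    have hdiv : ((64 * k * n / 2 ^ (l + i) : ℕ) : ℝ) ≤ 64 * k * n / 2 ^ (l + i) := by
      exact_mod_cast Nat.cast_div_le (α := ℝ) (m := 64 * k * n) (n := 2 ^ (l + i))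
    have hone : (1 : ℝ) ≤ k * n / 2 ^ (l + i) := by rwa [one_le_div (by positivity)]
    calc ((min n (g * (64 * k * n / 2 ^ (l + i) + 1)) : ℕ) : ℝ)
        ≤ (g * (64 * k * n / 2 ^ (l + i) + 1) : ℕ) := by exact_mod_cast min_le_right _ _
      _ = g * ((64 * k * n / 2 ^ (l + i) : ℕ) + 1) := by push_cast; rfl
      _ ≤ 2 ^ l * (64 * k * n / 2 ^ (l + i) + k * n / 2 ^ (l + i)) := by
          gcongr
          exact_mod_cast hg
      _ = _ := by
          rw [pow_add, div_pow, one_pow]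
          field_simp
          ring
  have h4 : (∑ i ∈ range s, f (l + i) : ℝ) ≤ 130 * k * n := by
    refine (sum_le_sum fun i _ => h3 i).trans ?_
    rw [← mul_sum]
    have := sum_geometric_two_le s
    have hkn : (0 : ℝ) ≤ 65 * k * n := by positivity
    nlinarith
  have h1' : ((∑ j ∈ range s, (1 + min n (g * (64 * k * n / 2 ^ j + 1))) : ℕ) : ℝ) ≤
      s + ((∑ j ∈ range l, f j : ℕ) + ∑ i ∈ range s, (f (l + i) : ℝ)) := by exact_mod_cast h1
  have h2' : ((∑ j ∈ range l, f j : ℕ) : ℝ) ≤ l * n := by exact_mod_cast h2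
  have hsn' : (s : ℝ) ≤ n := by exact_mod_cast hsn
  linarith

theorem ofReal_le_uniform {Ω α : Type*} [Fintype Ω] [Nonempty Ω] (F : Ω → α) (s : Set α) {δ : ℝ}
    (h : freq (fun ω => F ω ∉ s) ≤ δ) :
    ENNReal.ofReal (1 - δ) ≤ ((PMF.uniformOfFintype Ω).map F).toOuterMeasure s := by
  classical
  have hΩ : (0 : ℝ) < Fintype.card Ω := by exact_mod_cast Fintype.card_pos
  rw [freq_not] at h
  rw [PMF.toOuterMeasure_map_apply, PMF.toOuterMeasure_uniformOfFintype_apply]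
  refine (ENNReal.ofReal_le_ofReal (by linarith : 1 - δ ≤ freq fun ω => F ω ∈ s)).trans_eq ?_
  unfold freq
  rw [ENNReal.ofReal_div_of_pos hΩ, ENNReal.ofReal_natCast, ENNReal.ofReal_natCast,
    Fintype.card_subtype]
  congr!

theorem exists_algorithm_of_half_le {n k : ℕ} (hn : 2 ≤ n) (hk : 2 ≤ k) (hkn : k ≤ n) {δ : ℝ}
    (hδ : 0 < δ) (hδ1 : δ < 1) (hLL : 1 / 2 ≤ Real.logb 2 (Real.logb 2 (n / δ))) :
    ∃ m : ℕ,
      (m : ℝ) ≤ 34688 * n * Real.logb 2 (Real.logb 2 (n / δ)) * k * Real.logb 2 (k / δ) ∧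
      ∃ D : PMF ((Fin m → Finset (Fin n)) × ((Fin m → ℕ) → Setoid (Fin n))),
        ∀ c : Fin n → Fin k,
          ENNReal.ofReal (1 - δ) ≤
            D.toOuterMeasure {a | a.2 (fun i => clusterCount c (a.1 i)) = Setoid.ker c} := by
  have hn' : (2 : ℝ) ≤ n := by exact_mod_cast hn
  have hk' : (2 : ℝ) ≤ k := by exact_mod_cast hk
  have hkn' : (k : ℝ) ≤ n := by exact_mod_cast hkn
  set q := ⌈Real.logb 2 (2 * (k : ℝ) ^ 2 / δ)⌉₊ with hq
  set g := ⌈Real.logb 2 (2 * (n : ℝ) ^ 3 / δ)⌉₊ with hg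
  set L := Real.logb 2 (n / δ) with hL
  set l := ⌈Real.logb 2 (5 * L)⌉₊ with hl
  have hL1 : 1 ≤ L := by
    rw [hL, Real.le_logb_iff_rpow_le one_lt_two (by positivity), Real.rpow_one, le_div_iff₀ hδ]
    nlinarith
  have hq4 : (q : ℝ) ≤ 4 * Real.logb 2 (k / δ) := by
    have := ceil_logb_two_mul_pow_div_le hk' hδ hδ1 2 (by norm_num)
    norm_num at this
    exact this
  have hg5 : (g : ℝ) ≤ 5 * L := by
    have := ceil_logb_two_mul_pow_div_le hn' hδ hδ1 3 (by norm_num)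
    norm_num at this
    exact this
  have hgl : g ≤ 2 ^ l := by
    have h1 : 5 * L ≤ (2 : ℝ) ^ l := by
      rw [← Real.rpow_natCast, ← Real.logb_le_iff_le_rpow one_lt_two (by linarith)]
      exact Nat.le_ceil _
    exact_mod_cast hg5.trans h1
  have hl9 : (l : ℝ) ≤ 9 * Real.logb 2 L := by
    have h1 : Real.logb 2 (5 * L) = Real.logb 2 5 + Real.logb 2 L :=
      Real.logb_mul (by norm_num) (by linarith)
    have h2 : Real.logb 2 5 ≤ 3 := by
      rw [Real.logb_le_iff_le_rpow one_lt_two (by norm_num)]; norm_num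
    have h3 : 0 ≤ Real.logb 2 (5 * L) := Real.logb_nonneg one_lt_two (by linarith)
    have := Nat.ceil_lt_add_one h3
    linarith
  obtain ⟨m, Ω, _, _, Q, hm, hQ⟩ := exists_random_queries n k (32 * q) g (by omega)
  refine ⟨m, ?_, (PMF.uniformOfFintype Ω).map fun ω => (Q ω, decode (Fin k) (Q ω)), fun c =>
    ofReal_le_uniform _ _ ((hQ c).trans ?_)⟩
  · have hsum := sum_one_add_min_le (k := k) hn (by omega) hgl
    have hm' : (m : ℝ) ≤ 32 * q * (n + l * n + 130 * k * n) := by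
      refine le_trans (b := ((32 * q * _ : ℕ) : ℝ)) (by exact_mod_cast hm) ?_
      rw [Nat.cast_mul]
      push_cast at hsum ⊢
      gcongr
    have hq0 : 0 ≤ Real.logb 2 (k / δ) := by
      have : (0 : ℝ) ≤ q := by positivity
      linarith
    have hnk : (n : ℝ) ≤ k * n := by nlinarith
    have h1 : (n + l * n + 130 * k * n : ℝ) ≤ 271 * Real.logb 2 L * (k * n) := by
      have h2 : (l * n : ℝ) ≤ 9 * Real.logb 2 L * (k * n) := by gcongr
      nlinarith
    calc (m : ℝ) ≤ 32 * q * (n + l * n + 130 * k * n) := hm'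
      _ ≤ 32 * (4 * Real.logb 2 (k / δ)) * (271 * Real.logb 2 L * (k * n)) := by gcongr
      _ = _ := by ring
  · have h1 : (31 / 32 : ℝ) ^ (32 * q) ≤ 1 / (2 * (k : ℝ) ^ 2 / δ) := by
      refine le_trans ?_ (half_pow_ceil_logb_le (by positivity))
      rw [pow_mul]
      exact pow_le_pow_left₀ (by positivity) (by norm_num) _
    have h2 : (1 / 2 : ℝ) ^ g ≤ 1 / (2 * (n : ℝ) ^ 3 / δ) := half_pow_ceil_logb_le (by positivity)
    calc (k : ℝ) ^ 2 * ((31 / 32) ^ (32 * q) + n * (1 / 2) ^ g)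
        ≤ k ^ 2 * (1 / (2 * (k : ℝ) ^ 2 / δ)) + n ^ 2 * (n * (1 / (2 * (n : ℝ) ^ 3 / δ))) := by
          rw [mul_add]
          gcongr
      _ = δ := by
          field_simp
          ring

theorem exists_algorithm_without_queries {n k : ℕ} (hn : n = 2) {δ : ℝ}
    (hδ : 1 / 2 ≤ δ) :
    ∃ D : PMF ((Fin 0 → Finset (Fin n)) × ((Fin 0 → ℕ) → Setoid (Fin n))),
      ∀ c : Fin n → Fin k,
        ENNReal.ofReal (1 - δ) ≤
          D.toOuterMeasure {a | a.2 (fun i => clusterCount c (a.1 i)) = Setoid.ker c} := by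
  classical
  subst hn
  refine ⟨(PMF.uniformOfFintype Bool).map fun b => (fun _ => ∅, fun _ => if b then ⊤ else ⊥),
    fun c => ofReal_le_uniform _ _ (le_trans ?_ hδ)⟩
  have h : Setoid.ker c = if c 0 = c 1 then ⊤ else ⊥ := by
    split_ifs with h <;> ext x y <;> fin_cases x <;> fin_cases y <;>
      simp [Setoid.ker_def, Setoid.top_def, h, eq_comm (a := c 1)]
  refine le_trans (freq_mono (Q := fun b : Bool => b ≠ decide (c 0 = c 1)) fun b hb hb' => hb ?_) ?_
  · subst hb'
    simp [h]
  · rw [freq_not]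
    simp only [freq, filter_eq', mem_univ, if_true, card_singleton, Fintype.card_bool]
    norm_num

end Bounds

/-- There is a constant `C > 0` such that for all `n ≥ 2`, `2 ≤ k ≤ n`, `δ ∈ (0,1)`,
there is a non-adaptive randomized algorithm making at most
`C·n·log₂ log₂ (n/δ)·k·log₂(k/δ)` subset queries which, for every partition of an
`n`-point set into at most `k` clusters, outputs exactly that partition
with probability at least `1 - δ`. -/
theorem nonadaptive_clustering_small_k :
    ∃ C : ℝ, 0 < C ∧
      ∀ n k : ℕ, 2 ≤ n → 2 ≤ k → k ≤ n →
        ∀ δ : ℝ, 0 < δ → δ < 1 →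
          ∃ m : ℕ,
            (m : ℝ) ≤ C * n * Real.logb 2 (Real.logb 2 (n / δ)) * k * Real.logb 2 (k / δ) ∧
            ∃ D : PMF ((Fin m → Finset (Fin n)) × ((Fin m → ℕ) → Setoid (Fin n))),
              ∀ c : Fin n → Fin k,
                ENNReal.ofReal (1 - δ) ≤
                  D.toOuterMeasure
                    {a | a.2 (fun i => clusterCount c (a.1 i)) = Setoid.ker c} := by
  refine ⟨34688, by norm_num, fun n k hn hk hkn δ hδ hδ1 => ?_⟩
  have hk' : (2 : ℝ) ≤ k := by exact_mod_cast hk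
  have hn' : (2 : ℝ) ≤ n := by exact_mod_cast hn
  by_cases h3 : 3 ≤ n / δ
  · refine exists_algorithm_of_half_le hn hk hkn hδ hδ1 ?_
    have h1 : (3 / 2 : ℝ) ≤ Real.logb 2 (n / δ) := by
      rw [Real.le_logb_iff_rpow_le one_lt_two (by linarith)]
      refine le_trans ?_ h3
      rw [← pow_le_pow_iff_left₀ (by positivity) (by norm_num) two_ne_zero, ← Real.rpow_mul_natCast
        zero_le_two]
      norm_num
    rw [Real.le_logb_iff_rpow_le one_lt_two (by linarith), ← Real.sqrt_eq_rpow]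
    refine le_trans ?_ h1
    rw [Real.sqrt_le_left (by norm_num)]
    norm_num
  · rw [not_le, div_lt_iff₀ hδ] at h3
    have hn2 : n = 2 := by
      have : (n : ℝ) < 3 := by nlinarith
      have : n < 3 := by exact_mod_cast this
      omega
    have hlog : ∀ x : ℝ, 2 ≤ x → 1 ≤ Real.logb 2 (x / δ) := fun x hx => by
      rw [Real.le_logb_iff_rpow_le one_lt_two (by positivity), Real.rpow_one, le_div_iff₀ hδ]
      nlinarith
    refine ⟨0, ?_, exists_algorithm_without_queries hn2 (by linarith)⟩
    have h1 := Real.logb_nonneg one_lt_two (hlog n hn')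
    have h2 := hlog k hk'
    simp only [Nat.cast_zero]
    positivity
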